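/- arXiv:0712.1309 — 2 statements merged into one kernel-verified Lean document; each statement's English description precedes it below -/
import Mathlib

section
/- Let n ≥ 2 and D be integers with D² < 4n and let z = D/2 + i·√(n − D²/4) (so z² = Dz − n). Then the integer-part set equals the full lattice, I_z = ℤ + zℤ, if and only if D ≤ 1. -/
/-- The integer-part set `I_z` for base `z` and digits `{0,…,n-1}`. -/
def Iset (n : ℕ) (z : ℂ) : Set ℂ :=
  { x | ∃ N : ℕ, ∃ a : ℕ → ℕ, (∀ i, a i < n) ∧
      x = ∑ i ∈ Finset.range (N + 1), (a i : ℂ) * z ^ i }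

/-- `DigitRep n D a b` says that `a + b z`, where `z ^ 2 = D z - n`, has a finite expansion in base
`z` with digits in `{0, …, n - 1}`. -/
inductive DigitRep (n D : ℤ) : ℤ → ℤ → Prop
  | zero : DigitRep n D 0 0
  | step (x y q : ℤ) (h0 : 0 ≤ x + n * q) (h1 : x + n * q < n)
      (h : DigitRep n D (y - D * q) q) : DigitRep n D x y

namespace DigitRep

variable {n D : ℤ}

/-- A set of representable elements that is stable under all possible carries can be added to any
representable element. -/
theorem add_of_carry_stable {E : ℤ → ℤ → Prop} (hrep : ∀ x y, E x y → DigitRep n D x y)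
    (hE : ∀ x y d, E x y → 0 ≤ d → d < n →
      ∃ q, 0 ≤ x + d + n * q ∧ x + d + n * q < n ∧ E (y - D * q) q)
    {a b : ℤ} (hab : DigitRep n D a b) :
    ∀ x y, E x y → DigitRep n D (a + x) (b + y) := by
  induction hab with
  | zero => simpa using hrep
  | step a b q h0 h1 _ ih =>
    intro x y hxy
    obtain ⟨q', h0', h1', hE'⟩ := hE x y (a + n * q) hxy h0 h1
    refine step _ _ (q + q') (by linarith) (by linarith) ?_
    have := ih _ _ hE'
    convert this using 1
    ring

theorem forall_of_add (h10 : ∀ a b, DigitRep n D a b → DigitRep n D (a + 1) b)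
    (h10' : ∀ a b, DigitRep n D a b → DigitRep n D (a - 1) b) (c : ℤ)
    (h01 : ∀ a b, DigitRep n D a b → DigitRep n D (a + c) (b + 1))
    (h01' : ∀ a b, DigitRep n D a b → DigitRep n D (a - c) (b - 1)) (a b : ℤ) :
    DigitRep n D a b := by
  have hb : ∀ b, DigitRep n D (b * c) b := by
    intro b
    induction b with
    | zero => simpa using zero
    | succ i ih => convert h01 _ _ ih using 1; ring
    | pred i ih => convert h01' _ _ ih using 1; ring
  have ha : ∀ k, DigitRep n D (b * c + k) b := by
    intro k
    induction k with
    | zero => simpa using hb b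
    | succ i ih => convert h10 _ _ ih using 1; ring
    | pred i ih => convert h10' _ _ ih using 1; ring
  simpa using ha (a - b * c)

theorem forall_of_carry_stable {E : ℤ → ℤ → Prop} (hrep : ∀ x y, E x y → DigitRep n D x y)
    (hE : ∀ x y d, E x y → 0 ≤ d → d < n →
      ∃ q, 0 ≤ x + d + n * q ∧ x + d + n * q < n ∧ E (y - D * q) q)
    (c : ℤ) (h10 : E 1 0) (h10' : E (-1) 0) (h01 : E c 1) (h01' : E (-c) (-1)) (a b : ℤ) :
    DigitRep n D a b := by
  refine forall_of_add (fun a b h => ?_) (fun a b h => ?_) c (fun a b h => ?_) (fun a b h => ?_) a b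
  · simpa using add_of_carry_stable hrep hE h _ _ h10
  · simpa [sub_eq_add_neg] using add_of_carry_stable hrep hE h _ _ h10'
  · simpa using add_of_carry_stable hrep hE h _ _ h01
  · simpa [sub_eq_add_neg] using add_of_carry_stable hrep hE h _ _ h01'

theorem one_zero (hn : 2 ≤ n) : DigitRep n D 1 0 :=
  step _ _ 0 (by lia) (by lia) (by simpa using zero)

theorem forall_of_neg (hn : 2 ≤ n) (hD : D ≤ -1) (hDn : -n ≤ D) (a b : ℤ) : DigitRep n D a b := by
  have r1 : DigitRep n D 1 0 := one_zero hn
  have r2 : DigitRep n D (-D - 1) 1 :=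
    step _ _ 0 (by lia) (by lia) (by simpa using r1)
  have r3 : DigitRep n D D (-1) :=
    step _ _ 1 (by lia) (by lia) (by convert r2 using 1; ring)
  have r4 : DigitRep n D (-D) 1 ∧ DigitRep n D (-1) 0 ∧ DigitRep n D (1 + D) (-1) := by
    have key : DigitRep n D (-D) 1 → DigitRep n D (-1) 0 := fun h =>
      step _ _ 1 (by lia) (by lia) (by simpa using h)
    by_cases h1 : D = -1
    · have h : DigitRep n D (-D) 1 := step _ _ 0 (by lia) (by lia) (by simpa using r1)
      exact ⟨h, key h, step _ _ 0 (by lia) (by lia) (by simpa using key h)⟩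
    · have h5 : DigitRep n D (1 + D) (-1) :=
        step _ _ 1 (by lia) (by lia) (by convert r2 using 1; ring)
      have h : DigitRep n D (-D) 1 := by
        by_cases h2 : D = -n
        · exact step _ _ (-1) (by lia) (by lia) (by convert h5 using 1; ring)
        · exact step _ _ 0 (by lia) (by lia) (by simpa using r1)
      exact ⟨h, key h, h5⟩
  obtain ⟨r4, r5, r6⟩ := r4
  refine forall_of_carry_stable (c := -D)
    (E := fun x y => (x = 0 ∧ y = 0) ∨ (x = 1 ∧ y = 0) ∨ (x = -1 ∧ y = 0) ∨ (x = -D ∧ y = 1) ∨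
      (x = D ∧ y = -1) ∨ (x = -D - 1 ∧ y = 1) ∨ (x = 1 + D ∧ y = -1)) ?_ ?_
    (by simp) (by simp) (by simp) (by simp) a b
  · rintro x y (h | h | h | h | h | h | h) <;> obtain ⟨rfl, rfl⟩ := h <;>
      first | assumption | exact zero
  · intro x y d h h0 h1
    obtain h2 | h2 | h2 : x + d < 0 ∨ (0 ≤ x + d ∧ x + d < n) ∨ n ≤ x + d := by lia
    · exact ⟨1, by lia, by lia, by lia⟩
    · exact ⟨0, by lia, by lia, by lia⟩
    · exact ⟨-1, by lia, by lia, by lia⟩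

theorem forall_of_zero (hn : 2 ≤ n) (a b : ℤ) : DigitRep n 0 a b := by
  have r1 : DigitRep n 0 1 0 := one_zero hn
  have r2 : DigitRep n 0 0 1 := step _ _ 0 (by lia) (by lia) (by simpa using r1)
  have r3 : DigitRep n 0 1 1 := step _ _ 0 (by lia) (by lia) (by simpa using r1)
  have r4 : DigitRep n 0 (-1) 0 := step _ _ 1 (by lia) (by lia) (by simpa using r2)
  have r5 : DigitRep n 0 0 (-1) := step _ _ 0 (by lia) (by lia) (by simpa using r4)
  have r6 : DigitRep n 0 1 (-1) := step _ _ 0 (by lia) (by lia) (by simpa using r4)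
  have r7 : DigitRep n 0 (-1) 1 := step _ _ 1 (by lia) (by lia) (by simpa using r3)
  have r8 : DigitRep n 0 (-1) (-1) := step _ _ 1 (by lia) (by lia) (by simpa using r7)
  refine forall_of_carry_stable (c := 0)
    (E := fun x y => (x = -1 ∨ x = 0 ∨ x = 1) ∧ (y = -1 ∨ y = 0 ∨ y = 1)) ?_ ?_
    (by simp) (by simp) (by simp) (by simp) a b
  · rintro x y ⟨rfl | rfl | rfl, rfl | rfl | rfl⟩ <;> first | assumption | exact zero
  · intro x y d h h0 h1
    obtain h2 | h2 | h2 : x + d < 0 ∨ (0 ≤ x + d ∧ x + d < n) ∨ n ≤ x + d := by lia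
    · exact ⟨1, by lia, by lia, by lia⟩
    · exact ⟨0, by lia, by lia, by lia⟩
    · exact ⟨-1, by lia, by lia, by lia⟩

theorem forall_of_one (hn : 2 ≤ n) (a b : ℤ) : DigitRep n 1 a b := by
  have r1 : DigitRep n 1 1 0 := one_zero hn
  have r2 : DigitRep n 1 0 1 := step _ _ 0 (by lia) (by lia) (by simpa using r1)
  have r3 : DigitRep n 1 (-1) 1 := step _ _ 1 (by lia) (by lia) (by simpa using r2)
  have r4 : DigitRep n 1 (-1) 0 := step _ _ 1 (by lia) (by lia) (by simpa using r3)
  have r5 : DigitRep n 1 0 (-1) := step _ _ 0 (by lia) (by lia) (by simpa using r4)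
  have r6 : DigitRep n 1 1 (-1) := step _ _ 0 (by lia) (by lia) (by simpa using r4)
  refine forall_of_carry_stable (c := 0)
    (E := fun x y => (x = 0 ∧ y = 0) ∨ (x = 1 ∧ y = 0) ∨ (x = -1 ∧ y = 0) ∨ (x = 0 ∧ y = 1) ∨
      (x = 0 ∧ y = -1) ∨ (x = -1 ∧ y = 1) ∨ (x = 1 ∧ y = -1)) ?_ ?_
    (by simp) (by simp) (by simp) (by simp) a b
  · rintro x y (h | h | h | h | h | h | h) <;> obtain ⟨rfl, rfl⟩ := h <;>
      first | assumption | exact zero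
  · intro x y d h h0 h1
    obtain h2 | h2 | h2 : x + d < 0 ∨ (0 ≤ x + d ∧ x + d < n) ∨ n ≤ x + d := by lia
    · exact ⟨1, by lia, by lia, by lia⟩
    · exact ⟨0, by lia, by lia, by lia⟩
    · exact ⟨-1, by lia, by lia, by lia⟩

/-- For `2 ≤ D ≤ n`, the element `1 - D + z` is a fixed point of the digit-removal map. -/
theorem not_fixed_point (hD : 2 ≤ D) (hDn : D ≤ n) : ¬ DigitRep n D (1 - D) 1 := by
  suffices h : ∀ x y, DigitRep n D x y → ¬ (x = 1 - D ∧ y = 1) from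
    fun hr => h _ _ hr ⟨rfl, rfl⟩
  intro x y hr
  induction hr with
  | zero => lia
  | step x y q h0 h1 _ ih =>
    rintro ⟨rfl, rfl⟩
    have hq0 : 0 < q := by
      by_contra! hq
      nlinarith
    have hq1 : q < 2 := by
      by_contra! hq
      nlinarith
    obtain rfl : q = 1 := by lia
    exact ih ⟨by ring, rfl⟩

end DigitRep

theorem zero_mem_Iset {n : ℕ} (hn : 0 < n) (z : ℂ) : (0 : ℂ) ∈ Iset n z :=
  ⟨0, fun _ => 0, fun _ => hn, by simp⟩

theorem digit_add_mul_mem_Iset {n d : ℕ} {z x : ℂ} (hd : d < n) (hx : x ∈ Iset n z) :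
    (d : ℂ) + z * x ∈ Iset n z := by
  obtain ⟨N, a, ha, rfl⟩ := hx
  refine ⟨N + 1, fun i => Nat.casesOn i d a, fun i => by cases i <;> simp [hd, ha], ?_⟩
  rw [Finset.sum_range_succ' _ (N + 1), Finset.mul_sum, add_comm]
  congr 1
  · exact Finset.sum_congr rfl fun i _ => by ring
  · simp

theorem DigitRep.mem_Iset {n : ℕ} (hn : 0 < n) {D : ℤ} {z : ℂ} (hz : z ^ 2 = D * z - n) {a b : ℤ}
    (h : DigitRep n D a b) : (a : ℂ) + b * z ∈ Iset n z := by
  induction h with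
  | zero => simpa using zero_mem_Iset hn z
  | step x y q h0 h1 _ ih =>
    obtain ⟨d, hd⟩ := Int.eq_ofNat_of_zero_le h0
    have hdn : d < n := by lia
    convert digit_add_mul_mem_Iset hdn ih using 1
    have hd' : (x : ℂ) + n * q = d := by exact_mod_cast hd
    push_cast
    linear_combination hd' - q * hz

theorem exists_digitRep_of_mem_Iset {n : ℕ} {D : ℤ} {z : ℂ} (hz : z ^ 2 = D * z - n) {x : ℂ}
    (hx : x ∈ Iset n z) : ∃ a b : ℤ, DigitRep n D a b ∧ x = a + b * z := by
  obtain ⟨N, a, ha, rfl⟩ := hx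
  generalize N + 1 = M
  induction M generalizing a with
  | zero => exact ⟨0, 0, .zero, by simp⟩
  | succ M ih =>
    obtain ⟨u, v, huv, h⟩ := ih (fun i => a (i + 1)) fun i => ha _
    have ha0 := ha 0
    refine ⟨a 0 - n * v, u + D * v, .step _ _ v (by lia) (by lia) (by simpa using huv), ?_⟩
    have hs : ∑ i ∈ Finset.range M, (a (i + 1) : ℂ) * z ^ (i + 1) = z * (u + v * z) := by
      rw [← h, Finset.mul_sum]
      exact Finset.sum_congr rfl fun i _ => by ring
    rw [Finset.sum_range_succ', hs]
    push_cast
    linear_combination v * hz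

theorem stmt_12 (n : ℕ) (hn : 2 ≤ n) (D : ℤ) (hD : D ^ 2 < 4 * (n : ℤ))
    (z : ℂ) (hz : z = (D : ℂ) / 2 + Complex.I * (Real.sqrt ((n : ℝ) - (D : ℝ) ^ 2 / 4) : ℝ)) :
    Iset n z = { x : ℂ | ∃ a b : ℤ, x = (a : ℂ) + (b : ℂ) * z } ↔ D ≤ 1 := by
  have hpos : 0 < (n : ℝ) - (D : ℝ) ^ 2 / 4 := by
    have : (D : ℝ) ^ 2 < 4 * n := by exact_mod_cast hD
    linarith
  have him : z.im ≠ 0 := by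
    have h : z.im = √((n : ℝ) - (D : ℝ) ^ 2 / 4) := by simp [hz]
    rw [h]
    exact (Real.sqrt_pos.2 hpos).ne'
  have hz2 : z ^ 2 = D * z - n := by
    have hs : ((√((n : ℝ) - (D : ℝ) ^ 2 / 4) : ℝ) : ℂ) ^ 2 = n - (D : ℂ) ^ 2 / 4 := by
      rw [← Complex.ofReal_pow, Real.sq_sqrt hpos.le]
      push_cast
      ring
    rw [hz]
    linear_combination
      ((√((n : ℝ) - (D : ℝ) ^ 2 / 4) : ℝ) : ℂ) ^ 2 * Complex.I_sq - hs
  have hn' : (2 : ℤ) ≤ n := by exact_mod_cast hn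
  have habs : |D| ≤ n := by
    by_contra! h
    nlinarith [sq_abs D, sq_nonneg ((n : ℤ) - 1)]
  obtain ⟨hDn', hDn⟩ := abs_le.1 habs
  constructor
  · intro h
    by_contra! hD2
    have hmem : ((1 - D : ℤ) : ℂ) + ((1 : ℤ) : ℂ) * z ∈ Iset n z := h ▸ ⟨1 - D, 1, rfl⟩
    obtain ⟨a, b, hab, he⟩ := exists_digitRep_of_mem_Iset hz2 hmem
    have hb : b = 1 := by
      have h1 : z.im = b * z.im := by simpa using congrArg Complex.im he
      have h2 : (b : ℝ) = 1 := mul_right_cancel₀ him (by linarith)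
      exact_mod_cast h2
    subst hb
    have ha : 1 - D = a := by exact_mod_cast add_right_cancel he
    subst ha
    exact DigitRep.not_fixed_point hD2 hDn hab
  · intro hD1
    ext x
    constructor
    · intro hx
      obtain ⟨a, b, _, he⟩ := exists_digitRep_of_mem_Iset hz2 hx
      exact ⟨a, b, he⟩
    · rintro ⟨a, b, rfl⟩
      refine DigitRep.mem_Iset (by lia) hz2 ?_
      obtain h | rfl | rfl : D ≤ -1 ∨ D = 0 ∨ D = 1 := by lia
      · exact DigitRep.forall_of_neg hn' h hDn' a b
      · exact DigitRep.forall_of_zero hn' a b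
      · exact DigitRep.forall_of_one hn' a b
end

section
/- Let n ≥ 2 and D ≤ 1 be integers with D² < 4n, and let z = D/2 + i·√(n − D²/4). Then the translates of F_z by the lattice ℤ + zℤ tile the plane: (a) ⋃_{x ∈ ℤ+zℤ} (F_z + x) = ℂ; (b) for any two distinct x, y ∈ ℤ + zℤ, μ₂((F_z + x) ∩ (F_z + y)) = 0; and (c) μ₂(F_z) = Im z = √(n − D²/4), the area of the fundamental parallelogram spanned by 1 and z. -/
open MeasureTheory

/-- The fractional-part set `F_z` for base `z` and digits `{0,…,n-1}`. -/
def Fset (n : ℕ) (z : ℂ) : Set ℂ :=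
  { x | ∃ a : ℕ → ℕ, (∀ i, a i < n) ∧ x = ∑' i : ℕ, (a i : ℂ) * z⁻¹ ^ (i + 1) }

open scoped Pointwise

/-- The finite set of values `∑_{i<k} d_i z^i` with digits `d_i ∈ {0,…,n-1}`. -/
noncomputable def digitSums (n : ℕ) (z : ℂ) : ℕ → Finset ℂ
  | 0 => {0}
  | k + 1 => (Finset.range n ×ˢ digitSums n z k).image fun p => (p.1 : ℂ) + z * p.2

lemma card_digitSums_le (n : ℕ) (z : ℂ) (k : ℕ) : (digitSums n z k).card ≤ n ^ k := by
  induction k with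
  | zero => simp [digitSums]
  | succ k ih =>
    refine Finset.card_image_le.trans ?_
    rw [Finset.card_product, Finset.card_range, pow_succ']
    gcongr

lemma add_mul_mem_digitSums {n : ℕ} {z : ℂ} {k d : ℕ} (hd : d < n) {x : ℂ}
    (hx : x ∈ digitSums n z k) : (d : ℂ) + z * x ∈ digitSums n z (k + 1) :=
  Finset.mem_image.2 ⟨(d, x), by simp [hd, hx], rfl⟩

section Fset

variable {n : ℕ} {z : ℂ}

lemma norm_digit_term_le {a : ℕ → ℕ} (ha : ∀ i, a i < n) (i : ℕ) :
    ‖(a i : ℂ) * z⁻¹ ^ (i + 1)‖ ≤ n * ‖z‖⁻¹ ^ (i + 1) := by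
  rw [norm_mul, norm_pow, norm_inv, Complex.norm_natCast]
  have : (a i : ℝ) ≤ n := by exact_mod_cast (ha i).le
  gcongr

lemma summable_digit_bound (n : ℕ) (hz : 1 < ‖z‖) :
    Summable fun i : ℕ => (n : ℝ) * ‖z‖⁻¹ ^ (i + 1) :=
  (((summable_nat_add_iff 1).2
    (summable_geometric_of_lt_one (by positivity) (inv_lt_one_of_one_lt₀ hz)))).mul_left _

lemma summable_digit_term (hz : 1 < ‖z‖) {a : ℕ → ℕ} (ha : ∀ i, a i < n) :
    Summable fun i : ℕ => (a i : ℂ) * z⁻¹ ^ (i + 1) :=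
  .of_norm_bounded (summable_digit_bound n hz) (norm_digit_term_le ha)

lemma mul_tsum_digits (hz : 1 < ‖z‖) {a : ℕ → ℕ} (ha : ∀ i, a i < n) :
    z * ∑' i : ℕ, (a i : ℂ) * z⁻¹ ^ (i + 1) =
      (∑' i : ℕ, (a (i + 1) : ℂ) * z⁻¹ ^ (i + 1)) + a 0 := by
  have hz0 : z ≠ 0 := by rintro rfl; norm_num at hz
  rw [(summable_digit_term hz ha).tsum_eq_zero_add, mul_add, ← tsum_mul_left, add_comm]
  congr 1
  · refine tsum_congr fun i => ?_
    rw [pow_succ _ (i + 1)]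
    field_simp
  · rw [zero_add, pow_one]
    field_simp

lemma mem_Fset_iff (hz : 1 < ‖z‖) {y : ℂ} :
    y ∈ Fset n z ↔ ∃ d < n, ∃ x ∈ Fset n z, z * y = x + d := by
  have hz0 : z ≠ 0 := by rintro rfl; norm_num at hz
  constructor
  · rintro ⟨a, ha, rfl⟩
    exact ⟨a 0, ha 0, _, ⟨fun i => a (i + 1), fun i => ha _, rfl⟩, mul_tsum_digits hz ha⟩
  · rintro ⟨d, hd, x, ⟨a, ha, rfl⟩, h⟩
    obtain ⟨b, hb0, hb1⟩ : ∃ b : ℕ → ℕ, b 0 = d ∧ ∀ i, b (i + 1) = a i :=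
      ⟨fun i => Nat.casesOn i d a, rfl, fun _ => rfl⟩
    have hb : ∀ i, b i < n := by
      rintro (_ | i)
      · rwa [hb0]
      · rw [hb1]
        exact ha i
    refine ⟨b, hb, mul_left_cancel₀ hz0 ?_⟩
    rw [mul_tsum_digits hz hb, h, hb0]
    simp only [hb1]

lemma pow_mul_image_Fset (hz : 1 < ‖z‖) (k : ℕ) :
    (fun y => z ^ k * y) '' Fset n z = ⋃ s ∈ digitSums n z k, (fun y => y + s) '' Fset n z := by
  have hz0 : z ≠ 0 := by rintro rfl; norm_num at hz
  induction k with
  | zero => simp [digitSums]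
  | succ k ih =>
    have ih' (u : ℂ) := Set.ext_iff.1 ih u
    simp only [Set.mem_image, Set.mem_iUnion, exists_prop] at ih'
    ext u
    simp only [Set.mem_image, Set.mem_iUnion, exists_prop]
    constructor
    · rintro ⟨y, hy, rfl⟩
      obtain ⟨s, hs, x, hx, h⟩ := (ih' _).1 ⟨y, hy, rfl⟩
      obtain ⟨d, hd, x', hx', h'⟩ := (mem_Fset_iff hz).1 hx
      refine ⟨_, add_mul_mem_digitSums hd hs, x', hx', ?_⟩
      rw [pow_succ', mul_assoc, ← h, mul_add, h', add_assoc]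
    · rintro ⟨s, hs, x, hx, rfl⟩
      obtain ⟨⟨d, s'⟩, hp, rfl⟩ := Finset.mem_image.1 hs
      simp only [Finset.mem_product, Finset.mem_range] at hp
      obtain ⟨y, hy, h⟩ := (ih' _).2 ⟨s', hp.2, (x + d) / z,
        (mem_Fset_iff hz).2 ⟨d, hp.1, x, hx, by field_simp⟩, rfl⟩
      refine ⟨y, hy, ?_⟩
      rw [pow_succ', mul_assoc, h]
      field_simp
      ring

lemma isCompact_Fset (hz : 1 < ‖z‖) : IsCompact (Fset n z) := by
  have : Fset n z =
      Set.range fun a : ℕ → Fin n => ∑' i : ℕ, ((a i : ℕ) : ℂ) * z⁻¹ ^ (i + 1) := by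
    ext x
    constructor
    · rintro ⟨a, ha, rfl⟩
      exact ⟨fun i => ⟨a i, ha i⟩, rfl⟩
    · rintro ⟨a, rfl⟩
      exact ⟨fun i => a i, fun i => (a i).2, rfl⟩
  rw [this]
  refine isCompact_range (continuous_tsum (fun i => ?_) (summable_digit_bound n hz)
    fun i a => norm_digit_term_le (a := fun i => (a i : ℕ)) (fun i => (a i).2) i)
  exact ((continuous_of_discreteTopology (f := fun m : Fin n => ((m : ℕ) : ℂ))).comp
    (continuous_apply i)).mul continuous_const

lemma zero_mem_Fset (hn : 0 < n) : (0 : ℂ) ∈ Fset n z :=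
  ⟨fun _ => 0, fun _ => hn, by simp⟩

lemma volume_mul_image (w : ℂ) (s : Set ℂ) :
    volume ((fun y => w * y) '' s) = ENNReal.ofReal (Complex.normSq w) * volume s := by
  have h := Measure.addHaar_image_linearMap volume (LinearMap.mulLeft ℝ w) s
  have hdet : LinearMap.det (LinearMap.mulLeft ℝ w) = Complex.normSq w :=
    (Algebra.norm_apply ℝ w).symm.trans (Algebra.norm_complex_apply w)
  rw [hdet, abs_of_nonneg (Complex.normSq_nonneg w)] at h
  exact h

lemma volume_add_image (x : ℂ) (s : Set ℂ) : volume ((fun y => y + x) '' s) = volume s := by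
  rw [Set.image_add_right, measure_preimage_add_right]

/-- A union of `m` sets of measure at most `V` having measure at least `m V` is almost disjoint. -/
lemma measure_inter_eq_zero_of_card_mul_le {α ι : Type*} [MeasurableSpace α] {μ : Measure α}
    {S : Finset ι} {f : ι → Set α} {V : ENNReal} (hV : V ≠ ⊤) (hf : ∀ i, MeasurableSet (f i))
    (hle : ∀ i, μ (f i) ≤ V) (h : S.card * V ≤ μ (⋃ i ∈ S, f i)) {i j : ι} (hi : i ∈ S)
    (hj : j ∈ S) (hij : i ≠ j) : μ (f i ∩ f j) = 0 := by
  classical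
  set T := (S.erase i).erase j with hT
  have hj' : j ∈ S.erase i := Finset.mem_erase.2 ⟨hij.symm, hj⟩
  have hcard : S.card = T.card + 2 := by
    rw [← Finset.card_erase_add_one hi, ← Finset.card_erase_add_one hj']
  have hsub : (⋃ l ∈ S, f l) ⊆ (f i ∪ f j) ∪ ⋃ l ∈ T, f l := by
    intro x hx
    simp only [Set.mem_iUnion, exists_prop] at hx
    obtain ⟨l, hl, hx⟩ := hx
    by_cases h1 : l = i
    · subst h1; exact .inl (.inl hx)
    by_cases h2 : l = j
    · subst h2; exact .inl (.inr hx)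
    exact .inr (Set.mem_biUnion (by simp [hT, h1, h2, hl] : l ∈ T) hx)
  have hT' : μ (⋃ l ∈ T, f l) ≤ T.card * V := by
    refine (measure_biUnion_finset_le T f).trans ?_
    rw [← nsmul_eq_mul]
    exact Finset.sum_le_card_nsmul _ _ _ fun l _ => hle l
  have hfin : (S.card : ENNReal) * V ≠ ⊤ := ENNReal.mul_ne_top (by simp) hV
  have key : (S.card : ENNReal) * V + μ (f i ∩ f j) ≤ S.card * V + 0 := by
    calc (S.card : ENNReal) * V + μ (f i ∩ f j)
        ≤ (μ (f i ∪ f j) + T.card * V) + μ (f i ∩ f j) := by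
          gcongr
          exact h.trans ((measure_mono hsub).trans ((measure_union_le _ _).trans (by gcongr)))
      _ = (μ (f i) + μ (f j)) + T.card * V := by
          rw [← measure_union_add_inter (f i) (hf j)]; ring
      _ ≤ (V + V) + T.card * V := by gcongr <;> exact hle _
      _ = S.card * V + 0 := by rw [hcard]; push_cast; ring
  exact nonpos_iff_eq_zero.1 ((ENNReal.add_le_add_iff_left hfin).1 key)

lemma volume_inter_eq_zero_of_mem_digitSums (hz : 1 < ‖z‖) (hzn : Complex.normSq z = n) {k : ℕ}
    {x y : ℂ} (hx : x ∈ digitSums n z k) (hy : y ∈ digitSums n z k) (hxy : x ≠ y) :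
    volume (((fun w => w + x) '' Fset n z) ∩ ((fun w => w + y) '' Fset n z)) = 0 := by
  have hF := isCompact_Fset (n := n) hz
  refine measure_inter_eq_zero_of_card_mul_le (f := fun x => (fun w => w + x) '' Fset n z)
    (S := digitSums n z k) hF.measure_ne_top
    (fun x => (hF.image (by fun_prop)).measurableSet) (fun x => (volume_add_image x _).le) ?_
    hx hy hxy
  rw [← pow_mul_image_Fset hz, volume_mul_image, map_pow, hzn,
    ENNReal.ofReal_pow (by positivity), ENNReal.ofReal_natCast]
  gcongr
  exact_mod_cast card_digitSums_le n z k

lemma volume_inter_add_eq_zero_of_sub_eq (hz : 1 < ‖z‖) (hzn : Complex.normSq z = n) {k : ℕ}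
    {x y x' y' : ℂ} (hx : x ∈ digitSums n z k) (hy : y ∈ digitSums n z k) (hne : x' ≠ y')
    (h : x' - y' = x - y) :
    volume (((fun w => w + x') '' Fset n z) ∩ ((fun w => w + y') '' Fset n z)) = 0 := by
  have hxy : x ≠ y := sub_ne_zero.1 (h ▸ sub_ne_zero.2 hne)
  rw [← volume_inter_eq_zero_of_mem_digitSums hz hzn hx hy hxy, ← volume_add_image (x' - x)
    (((fun w => w + x) '' Fset n z) ∩ ((fun w => w + y) '' Fset n z)),
    Set.image_inter (add_left_injective _), Set.image_image, Set.image_image]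
  congr 4 <;> funext w
  · ring
  · linear_combination -h

end Fset

section SignedDigits

variable {n : ℕ} {D : ℤ} {z : ℂ}

lemma exists_digitSums_sub_eq_step {d : ℤ} (hd : |d| < n) {w : ℂ}
    (hw : ∃ k, ∃ x ∈ digitSums n z k, ∃ y ∈ digitSums n z k, w = x - y) :
    ∃ k, ∃ x ∈ digitSums n z k, ∃ y ∈ digitSums n z k, (d : ℂ) + z * w = x - y := by
  obtain ⟨k, x, hx, y, hy, rfl⟩ := hw
  rw [abs_lt] at hd
  refine ⟨k + 1, _, add_mul_mem_digitSums (d := d.toNat) (by omega) hx, _,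
    add_mul_mem_digitSums (d := (-d).toNat) (by omega) hy, ?_⟩
  have h : (d : ℂ) = (d.toNat : ℂ) - ((-d).toNat : ℂ) := by
    have : d = (d.toNat : ℤ) - ((-d).toNat : ℤ) := by omega
    exact_mod_cast congrArg (Int.cast : ℤ → ℂ) this
  rw [h]
  ring

lemma normSq_int_add_int_mul (hre : z.re = D / 2) (hns : Complex.normSq z = n) (a b : ℤ) :
    Complex.normSq (a + b * z) = ((a ^ 2 + D * a * b + n * b ^ 2 : ℤ) : ℝ) := by
  rw [Complex.normSq_apply] at *
  simp only [Complex.add_re, Complex.intCast_re, Complex.mul_re, Complex.intCast_im,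
    Complex.add_im, Complex.mul_im]
  push_cast
  rw [← hns, hre]
  ring

lemma exists_normSq_eq_natCast (hre : z.re = D / 2) (hns : Complex.normSq z = n)
    (hsq : z ^ 2 = D * z - n) (a b c : ℤ) :
    ∃ N : ℕ, Complex.normSq (a + b * z + c * z ^ 2) = N := by
  have h : (a : ℂ) + b * z + c * z ^ 2 = ((a - n * c : ℤ) : ℂ) + ((b + D * c : ℤ) : ℂ) * z := by
    rw [hsq]; push_cast; ring
  have h0 := Complex.normSq_nonneg ((a : ℂ) + b * z + c * z ^ 2)
  rw [h, normSq_int_add_int_mul hre hns] at h0 ⊢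
  obtain ⟨N, hN⟩ := Int.eq_ofNat_of_zero_le (Int.cast_nonneg_iff.1 h0)
  exact ⟨N, by rw [hN, Int.cast_natCast]⟩

/-- If `n` can be rewritten as `c₁ z + c₂ z² + c₃ z³` with `|c₁| + |c₂| + |c₃| ≤ n`, then carrying
terminates and yields finite expansions with digits of absolute value less than `n`. -/
lemma exists_digitSums_sub_eq_of_carry (hn : 2 ≤ n) (hre : z.re = D / 2)
    (hns : Complex.normSq z = n) (hsq : z ^ 2 = D * z - n) {c₁ c₂ c₃ : ℤ}
    (hc : |c₁| + |c₂| + |c₃| ≤ n) (hcz : (n : ℂ) = c₁ * z + c₂ * z ^ 2 + c₃ * z ^ 3)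
    (a b c : ℤ) :
    ∃ k, ∃ x ∈ digitSums n z k, ∃ y ∈ digitSums n z k,
      (a : ℂ) + b * z + c * z ^ 2 = x - y := by
  obtain ⟨M, hM⟩ : ∃ M : ℕ, |a| + |b| + |c| = M := ⟨_, (Int.toNat_of_nonneg (by positivity)).symm⟩
  obtain ⟨N, hN⟩ := exists_normSq_eq_natCast hre hns hsq a b c
  induction M using Nat.strong_induction_on generalizing a b c N with
  | _ M ihM =>
  induction N using Nat.strong_induction_on generalizing a b c with
  | _ N ihN =>
  by_cases h0 : (a : ℂ) + b * z + c * z ^ 2 = 0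
  · exact ⟨0, 0, by simp [digitSums], 0, by simp [digitSums], by simpa using h0⟩
  set q := a.tdiv n with hq
  set d := a.tmod n with hd
  have ha : a = d + n * q := (Int.tmod_add_mul_tdiv a n).symm
  have hqabs : |q| = |a| / n := by
    rw [Int.abs_eq_natAbs, Int.abs_eq_natAbs, hq, Int.natAbs_tdiv, Int.natAbs_natCast]
    exact Int.natCast_div _ _
  have hdabs : |d| = |a| % n := by
    rw [Int.abs_eq_natAbs, Int.abs_eq_natAbs, hd, Int.natAbs_tmod]
    simp
  have hadq : |a| = |d| + n * |q| := by
    rw [hqabs, hdabs, Int.emod_add_mul_ediv]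
  have hdn : |d| < n := hdabs ▸ Int.emod_lt_of_pos _ (by omega)
  have hsum : |b + c₁ * q| + |c + c₂ * q| + |c₃ * q| + |d| ≤ M := by
    have h1 := abs_add_le b (c₁ * q)
    have h2 := abs_add_le c (c₂ * q)
    rw [abs_mul] at *
    have h3 := mul_le_mul_of_nonneg_right hc (abs_nonneg q)
    linarith
  have hw : (a : ℂ) + b * z + c * z ^ 2 = d + z * (((b + c₁ * q : ℤ) : ℂ) +
      ((c + c₂ * q : ℤ) : ℂ) * z + ((c₃ * q : ℤ) : ℂ) * z ^ 2) := by
    rw [ha]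
    push_cast
    linear_combination (q : ℂ) * hcz
  obtain ⟨N', hN'⟩ :=
    exists_normSq_eq_natCast hre hns hsq (b + c₁ * q) (c + c₂ * q) (c₃ * q)
  obtain ⟨M', hM'⟩ : ∃ M' : ℕ, |b + c₁ * q| + |c + c₂ * q| + |c₃ * q| = M' :=
    ⟨_, (Int.toNat_of_nonneg (by positivity)).symm⟩
  have hd0 := abs_nonneg d
  rw [hM'] at hsum
  rw [hw]
  refine exists_digitSums_sub_eq_step hdn ?_
  rcases (show M' ≤ M by omega).lt_or_eq with hlt | rfl
  · exact ihM M' hlt _ _ _ hM' N' hN'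
  · have hdz : d = 0 := abs_eq_zero.1 (by omega)
    rw [hw, hdz, Int.cast_zero, zero_add] at h0 hN
    rw [map_mul, hns, hN'] at hN
    have hN0 : N' ≠ 0 := by
      rintro rfl
      rw [Nat.cast_zero, Complex.normSq_eq_zero] at hN'
      exact h0 (by rw [hN', mul_zero])
    have hNN : n * N' = N := by exact_mod_cast hN
    exact ihN N' (by nlinarith [Nat.pos_of_ne_zero hN0]) _ _ _ hM' hN'

lemma exists_digitSums_sub_eq (hn : 2 ≤ n) (hD1 : D ≤ 1) (hD : D ^ 2 < 4 * (n : ℤ))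
    (hre : z.re = D / 2) (hns : Complex.normSq z = n) (hsq : z ^ 2 = D * z - n) (a b : ℤ) :
    ∃ k, ∃ x ∈ digitSums n z k, ∃ y ∈ digitSums n z k, (a : ℂ) + b * z = x - y := by
  obtain ⟨c₁, c₂, c₃, hc, hcz⟩ : ∃ c₁ c₂ c₃ : ℤ, |c₁| + |c₂| + |c₃| ≤ n ∧
      (n : ℂ) = c₁ * z + c₂ * z ^ 2 + c₃ * z ^ 3 := by
    rcases le_or_gt 0 D with h | h
    · refine ⟨D, -1, 0, ?_, ?_⟩
      · rw [abs_of_nonneg h]; norm_num; omega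
      · push_cast; linear_combination hsq
    · have hDn : -D ≤ n := by
        by_contra! hlt
        have h4 : -4 < D := by nlinarith
        interval_cases D <;> omega
      refine ⟨n + D, -D - 1, 1, ?_, ?_⟩
      · rw [abs_of_nonneg (by omega), abs_of_nonneg (by omega), abs_one]; omega
      · push_cast; linear_combination (1 - z) * hsq
  simpa using exists_digitSums_sub_eq_of_carry hn hre hns hsq hc hcz a b 0

end SignedDigits

section Lattice

variable {n : ℕ} {D : ℤ} {z : ℂ}

/-- The basis `1, z` of `ℂ` over `ℝ`. -/
noncomputable def basisOneSelf (hz : z.im ≠ 0) : Module.Basis (Fin 2) ℝ ℂ :=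
  basisOfLinearIndependentOfCardEqFinrank (b := ![1, z])
    (by
      rw [LinearIndependent.pair_iff]
      intro s t h
      have h1 := congrArg Complex.im h
      have h2 := congrArg Complex.re h
      simp [hz] at h1
      simpa [h1] using h2)
    (by simp)

lemma coe_basisOneSelf (hz : z.im ≠ 0) : ⇑(basisOneSelf hz) = ![1, z] :=
  coe_basisOfLinearIndependentOfCardEqFinrank _ _

lemma mem_span_basisOneSelf (hz : z.im ≠ 0) {x : ℂ} :
    x ∈ Submodule.span ℤ (Set.range (basisOneSelf hz)) ↔ ∃ a b : ℤ, x = (a : ℂ) + (b : ℂ) * z := by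
  rw [coe_basisOneSelf, Matrix.range_cons_cons_empty, Submodule.mem_span_pair]
  simp [eq_comm]

lemma volume_fundamentalDomain_basisOneSelf (hz : z.im ≠ 0) :
    volume (ZSpan.fundamentalDomain (basisOneSelf hz)) = ENNReal.ofReal |z.im| := by
  rw [ZSpan.measure_fundamentalDomain _ _ Complex.orthonormalBasisOneI.toBasis,
    measure_congr (ZSpan.fundamentalDomain_ae_parallelepiped _ volume),
    OrthonormalBasis.coe_toBasis, OrthonormalBasis.volume_parallelepiped, mul_one]
  congr 2
  simp [Module.Basis.det_apply, Matrix.det_fin_two, Module.Basis.toMatrix_apply, coe_basisOneSelf]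

lemma Fset_add_span_eq_univ (hn : 0 < n) (hz1 : 1 < ‖z‖) (hz : z.im ≠ 0)
    (hsq : z ^ 2 = D * z - n) :
    Fset n z + (Submodule.span ℤ (Set.range (basisOneSelf hz)) : Set ℂ) = Set.univ := by
  have hz0 : z ≠ 0 := by rintro rfl; norm_num at hz1
  set b := basisOneSelf hz
  set L := Submodule.span ℤ (Set.range b)
  have hL : IsClosed (L : Set ℂ) :=
    AddSubgroup.isClosed_of_discrete (H := L.toAddSubgroup)
  have hcl : IsClosed (Fset n z + (L : Set ℂ)) := hL.add_left_of_isCompact (isCompact_Fset hz1)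
  have hdiv : ∀ u ∈ Fset n z + (L : Set ℂ), u / z ∈ Fset n z + (L : Set ℂ) := by
    rintro _ ⟨f, hf, l, hl, rfl⟩
    obtain ⟨p, q, rfl⟩ := (mem_span_basisOneSelf hz).1 hl
    have hn' : (0 : ℤ) < n := by exact_mod_cast hn
    have hm0 := Int.emod_nonneg p hn'.ne'
    have hm1 := Int.emod_lt_of_pos p hn'
    refine ⟨(f + (p % n).toNat) / z, (mem_Fset_iff hz1).2 ⟨(p % n).toNat, by omega, f, hf,
      by field_simp⟩, ((q + D * (p / n) : ℤ) : ℂ) + ((-(p / n) : ℤ) : ℂ) * z,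
      (mem_span_basisOneSelf hz).2 ⟨_, _, rfl⟩, ?_⟩
    have h1 : (((p % n).toNat : ℕ) : ℂ) = (p : ℂ) - n * ((p / n : ℤ) : ℂ) := by
      have : (((p % n).toNat : ℕ) : ℤ) = p - n * (p / n) := by
        rw [Int.toNat_of_nonneg hm0, Int.emod_def]
      exact_mod_cast congrArg (Int.cast : ℤ → ℂ) this
    simp only
    rw [h1]
    field_simp
    push_cast
    linear_combination (-((p / n : ℤ) : ℂ)) * hsq
  have hdivk : ∀ (k : ℕ), ∀ u ∈ Fset n z + (L : Set ℂ), u / z ^ k ∈ Fset n z + (L : Set ℂ) := by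
    intro k
    induction k with
    | zero => simp
    | succ k ih =>
      intro u hu
      rw [pow_succ, ← div_div]
      exact hdiv _ (ih u hu)
  rw [Set.eq_univ_iff_forall]
  intro w
  obtain ⟨C, hC⟩ := (ZSpan.fundamentalDomain_isBounded b).exists_norm_le
  have hlim : Filter.Tendsto (fun k : ℕ => ((ZSpan.floor b (z ^ k * w) : L) : ℂ) / z ^ k)
      Filter.atTop (nhds w) := by
    rw [tendsto_iff_norm_sub_tendsto_zero]
    have hg : Filter.Tendsto (fun k : ℕ => C * ‖z‖⁻¹ ^ k) Filter.atTop (nhds 0) := by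
      simpa using (tendsto_pow_atTop_nhds_zero_of_lt_one (by positivity)
        (inv_lt_one_of_one_lt₀ hz1)).const_mul C
    refine squeeze_zero (fun _ => norm_nonneg _) (fun k => ?_) hg
    have h2 : ((ZSpan.floor b (z ^ k * w) : L) : ℂ) / z ^ k - w =
        -(ZSpan.fract b (z ^ k * w) * z⁻¹ ^ k) := by
      rw [ZSpan.fract_apply, inv_pow]
      field_simp
      ring
    rw [h2, norm_neg, norm_mul, norm_pow, norm_inv]
    gcongr
    exact hC _ (ZSpan.fract_mem_fundamentalDomain b _)
  refine hcl.mem_of_tendsto hlim (.of_forall fun k => hdivk k _ ?_)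
  exact ⟨0, zero_mem_Fset hn, _, (ZSpan.floor b (z ^ k * w)).2, zero_add _⟩

end Lattice

theorem stmt_16 (n : ℕ) (hn : 2 ≤ n) (D : ℤ) (hD1 : D ≤ 1) (hD : D ^ 2 < 4 * (n : ℤ))
    (z : ℂ) (hz : z = (D : ℂ) / 2 + Complex.I * (Real.sqrt ((n : ℝ) - (D : ℝ) ^ 2 / 4) : ℝ)) :
    (⋃ x ∈ { x : ℂ | ∃ a b : ℤ, x = (a : ℂ) + (b : ℂ) * z },
        (fun y => y + x) '' Fset n z) = Set.univ ∧
      (∀ x y : ℂ, (∃ a b : ℤ, x = (a : ℂ) + (b : ℂ) * z) →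
        (∃ a b : ℤ, y = (a : ℂ) + (b : ℂ) * z) → x ≠ y →
        volume (((fun w => w + x) '' Fset n z) ∩ ((fun w => w + y) '' Fset n z)) = 0) ∧
      volume (Fset n z) = ENNReal.ofReal z.im ∧
      z.im = Real.sqrt ((n : ℝ) - (D : ℝ) ^ 2 / 4) := by
  set s := Real.sqrt ((n : ℝ) - (D : ℝ) ^ 2 / 4) with hs
  have hDR : (D : ℝ) ^ 2 < 4 * n := by exact_mod_cast hD
  have hspos : 0 < s := Real.sqrt_pos.2 (by linarith)
  have hs2 : s ^ 2 = n - (D : ℝ) ^ 2 / 4 := Real.sq_sqrt (by linarith)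
  have hre : z.re = D / 2 := by rw [hz]; simp
  have him : z.im = s := by rw [hz]; simp
  have him0 : z.im ≠ 0 := him ▸ hspos.ne'
  have hns : Complex.normSq z = n := by
    rw [Complex.normSq_apply, hre, him]; linarith
  have hsq : z ^ 2 = D * z - n := by
    apply Complex.ext
    · simp only [sq, Complex.mul_re, Complex.sub_re, Complex.intCast_re, Complex.intCast_im,
        Complex.natCast_re, hre, him]
      linarith
    · simp only [sq, Complex.mul_im, Complex.sub_im, Complex.intCast_re, Complex.intCast_im,
        Complex.natCast_im, hre, him]
      ring
  have hz1 : 1 < ‖z‖ := by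
    have h2 : (2 : ℝ) ≤ n := by exact_mod_cast hn
    have := Complex.normSq_eq_norm_sq z
    nlinarith [norm_nonneg z]
  have hcov := Fset_add_span_eq_univ (by omega) hz1 him0 hsq
  have hdisj : ∀ x y : ℂ, (∃ a b : ℤ, x = (a : ℂ) + (b : ℂ) * z) →
      (∃ a b : ℤ, y = (a : ℂ) + (b : ℂ) * z) → x ≠ y →
      volume (((fun w => w + x) '' Fset n z) ∩ ((fun w => w + y) '' Fset n z)) = 0 := by
    rintro _ _ ⟨a, b, rfl⟩ ⟨a', b', rfl⟩ hxy
    obtain ⟨k, x, hx, y, hy, h⟩ :=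
      exists_digitSums_sub_eq hn hD1 hD hre hns hsq (a - a') (b - b')
    exact volume_inter_add_eq_zero_of_sub_eq hz1 hns hx hy hxy (by rw [← h]; push_cast; ring)
  refine ⟨?_, hdisj, ?_, him⟩
  · rw [Set.eq_univ_iff_forall] at hcov ⊢
    intro w
    obtain ⟨f, hf, l, hl, rfl⟩ := hcov w
    exact Set.mem_biUnion ((mem_span_basisOneSelf him0).1 hl) ⟨f, hf, rfl⟩
  · rw [← abs_of_pos (him ▸ hspos : 0 < z.im), ← volume_fundamentalDomain_basisOneSelf him0]
    have hdom : IsAddFundamentalDomain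
        (Submodule.span ℤ (Set.range (basisOneSelf him0))).toAddSubgroup (Fset n z) volume := by
      refine ⟨(isCompact_Fset hz1).measurableSet.nullMeasurableSet, .of_forall fun w => ?_, ?_⟩
      · obtain ⟨f, hf, l, hl, h⟩ := (Set.eq_univ_iff_forall.1 hcov) w
        refine ⟨⟨-l, neg_mem hl⟩, ?_⟩
        have : -l + w = f := by rw [← h]; ring
        change -l + w ∈ _
        rwa [this]
      · intro x y hxy
        have h (u : ℂ) : u +ᵥ Fset n z = (fun w => w + u) '' Fset n z :=
          Set.image_congr fun w _ => add_comm u w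
        change volume (((x : ℂ) +ᵥ Fset n z) ∩ ((y : ℂ) +ᵥ Fset n z)) = 0
        rw [h, h]
        exact hdisj _ _ ((mem_span_basisOneSelf him0).1 x.2) ((mem_span_basisOneSelf him0).1 y.2)
          (Subtype.coe_injective.ne hxy)
    have : Countable (Submodule.span ℤ (Set.range (basisOneSelf him0))).toAddSubgroup :=
      inferInstanceAs (Countable (Submodule.span ℤ (Set.range (basisOneSelf him0))))
    exact hdom.measure_eq (ZSpan.isAddFundamentalDomain' _ volume)
end
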